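/- Let Δ ≥ 3 and let G be a finite connected Δ-regular simple graph that is not isomorphic to the complete graph K_{Δ+1}. Let p_A and p_B be non-negative integers with p_A + p_B = Δ − 2. Then the vertex set of G can be partitioned into sets A and B such that the induced subgraph G[A] is p_A-degenerate and the induced subgraph G[B] is p_B-degenerate. -/

import Mathlib

/-- `G[A]` is `d`-degenerate: every non-empty `B ⊆ A` contains a vertex having at
most `d` neighbors inside `B`. -/
def DegenerateOn {V : Type*} [DecidableEq V] (G : SimpleGraph V) [DecidableRel G.Adj]
    (A : Finset V) (d : ℕ) : Prop :=
  ∀ B : Finset V, B ⊆ A → B.Nonempty → ∃ v ∈ B, (B.filter (fun u => G.Adj v u)).card ≤ d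

section Bipartitioning

open Finset Relation

variable {V : Type*} {G : SimpleGraph V} {v : V} {m : ℕ} {p : ℕ → V}

/-- The vertices `p 0, …, p m` form a path which together with `v` is a cycle, and `p 0`, `p m`
are the only neighbours of `v` on it. -/
structure IsEar (G : SimpleGraph V) (v : V) (m : ℕ) (p : ℕ → V) : Prop where
  two_le : 2 ≤ m
  inj : ∀ i j, i ≤ m → j ≤ m → p i = p j → i = j
  ne : ∀ i, i ≤ m → p i ≠ v
  adj : ∀ i, i < m → G.Adj (p i) (p (i + 1))
  adj_iff : ∀ i, i ≤ m → (G.Adj v (p i) ↔ i = 0 ∨ i = m)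

/-- Two neighbours `s ≠ t` of `v` attached to a common connected set `W` far from `v` are the ends
of an ear. -/
theorem exists_isEar {W : Set V} {x s t a b : V} (hWv : ∀ w ∈ W, w ≠ v ∧ ¬ G.Adj v w)
    (hW : ∀ w ∈ W, ReflTransGen (fun a b => G.Adj a b ∧ a ∈ W ∧ b ∈ W) x w)
    (hvs : G.Adj v s) (hvt : G.Adj v t) (hst : s ≠ t) (ha : a ∈ W) (hb : b ∈ W)
    (hsa : G.Adj s a) (htb : G.Adj t b) :
    ∃ m p, IsEar G v m p := by
  let H : SimpleGraph V :=
    { Adj := fun y z => G.Adj y z ∧ (y ∈ W ∨ z ∈ W) ∧ (y ∈ W ∨ y = s ∨ y = t) ∧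
        (z ∈ W ∨ z = s ∨ z = t)
      symm := ⟨fun y z h => ⟨h.1.symm, h.2.1.symm, h.2.2.2, h.2.2.1⟩⟩
      loopless := ⟨fun y h => G.irrefl h.1⟩ }
  have hsW : s ∉ W := fun h => (hWv s h).2 hvs
  have htW : t ∉ W := fun h => (hWv t h).2 hvt
  have hreach : ∀ w ∈ W, H.Reachable x w := by
    intro w hw
    have := hW w hw
    clear hw
    induction this with
    | refl => exact SimpleGraph.Reachable.refl _
    | tail _ h ih =>
      have hadj : H.Adj _ _ := ⟨h.1, Or.inl h.2.1, Or.inl h.2.1, Or.inl h.2.2⟩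
      exact ih.trans hadj.reachable
  have h1 : H.Adj s a := ⟨hsa, Or.inr ha, Or.inr (Or.inl rfl), Or.inl ha⟩
  have h2 : H.Adj t b := ⟨htb, Or.inr hb, Or.inr (Or.inr rfl), Or.inl hb⟩
  obtain ⟨P, hP⟩ := ((h1.reachable.trans (hreach a ha).symm).trans
    ((hreach b hb).trans h2.symm.reachable)).exists_isPath
  have hinj : ∀ i j, i ≤ P.length → j ≤ P.length → P.getVert i = P.getVert j → i = j :=
    fun i j hi hj e => hP.getVert_injOn hi hj e
  have hmem : ∀ i ≤ P.length, P.getVert i ∈ W ∨ i = 0 ∨ i = P.length := by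
    intro i hi
    by_cases h0 : i = 0
    · exact Or.inr (Or.inl h0)
    by_cases hl : i = P.length
    · exact Or.inr (Or.inr hl)
    have hadj := P.adj_getVert_succ (lt_of_le_of_ne hi hl)
    rcases hadj.2.2.1 with h | h | h
    · exact Or.inl h
    · exact absurd (hinj i 0 hi (Nat.zero_le _) (by rw [h, P.getVert_zero])) h0
    · exact absurd (hinj i _ hi le_rfl (by rw [h, P.getVert_length])) hl
  have hlen : 2 ≤ P.length := by
    by_contra! h
    have h0 : P.length ≠ 0 := fun h0 => hst (SimpleGraph.Walk.eq_of_length_eq_zero h0)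
    have h1 : P.length = 1 := by omega
    have := (SimpleGraph.Walk.adj_of_length_eq_one h1).2.1
    tauto
  refine ⟨P.length, P.getVert, hlen, hinj, fun i hi => ?_,
    fun i hi => (P.adj_getVert_succ hi).1, fun i hi => ⟨fun h => ?_, ?_⟩⟩
  · rcases hmem i hi with h | rfl | rfl
    · exact (hWv _ h).1
    · rw [P.getVert_zero]
      exact hvs.ne'
    · rw [P.getVert_length]
      exact hvt.ne'
  · exact (hmem i hi).resolve_left fun hw => (hWv _ hw).2 h
  · rintro (rfl | rfl)
    · rwa [P.getVert_zero]
    · rwa [P.getVert_length]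

variable [DecidableEq V] [DecidableRel G.Adj]

theorem DegenerateOn.mono {A B : Finset V} {d : ℕ} (h : DegenerateOn G B d) (hAB : A ⊆ B) :
    DegenerateOn G A d :=
  fun C hC hne => h C (hC.trans hAB) hne

theorem DegenerateOn.insert {A : Finset V} {d : ℕ} {v : V} (h : DegenerateOn G A d)
    (hv : (A.filter (fun u => G.Adj v u)).card ≤ d) : DegenerateOn G (insert v A) d := by
  intro B hB hne
  by_cases hvB : v ∈ B
  · refine ⟨v, hvB, (card_le_card fun u hu => ?_).trans hv⟩
    rw [mem_filter] at hu ⊢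
    refine ⟨(mem_insert.1 (hB hu.1)).resolve_left ?_, hu.2⟩
    rintro rfl
    exact G.irrefl hu.2
  · exact h B ((subset_insert_iff_of_notMem hvB).1 hB) hne

variable [Fintype V]

/-- The colouring `c` partitions `G - h` into a `q true`-degenerate and a `q false`-degenerate
part; the colour of the hole `h` is irrelevant. -/
def IsHoleColoring (G : SimpleGraph V) [DecidableRel G.Adj] (q : Bool → ℕ) (h : V)
    (c : V → Bool) : Prop :=
  ∀ b, DegenerateOn G ((univ.erase h).filter (fun u => c u = b)) (q b)

/-- No two-colouring of all of `G` has degenerate colour classes. -/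
def NoPartition (G : SimpleGraph V) [DecidableRel G.Adj] (q : Bool → ℕ) : Prop :=
  ∀ c : V → Bool, ¬ ∀ b, DegenerateOn G (univ.filter (fun u => c u = b)) (q b)

variable {q : Bool → ℕ}

/-- A proper vertex subset of a connected graph can be coloured greedily. -/
theorem exists_coloring_of_ne_univ (hconn : G.Connected)
    (hdeg : ∀ v, G.degree v ≤ q true + q false + 2) (S : Finset V) (hS : S ≠ univ) :
    ∃ c : V → Bool, ∀ b, DegenerateOn G (S.filter (fun u => c u = b)) (q b) := by
  induction S using Finset.strongInduction with
  | H S ih =>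
  rcases S.eq_empty_or_nonempty with rfl | ⟨x, hx⟩
  · exact ⟨fun _ => true, fun b B hB hne => by simp_all⟩
  obtain ⟨y, hy⟩ : ∃ y, y ∉ S := by
    by_contra! h
    exact hS (eq_univ_iff_forall.2 h)
  obtain ⟨w⟩ := hconn.preconnected x y
  obtain ⟨e, -, heS, heS'⟩ := w.exists_boundary_dart (S : Set V) hx hy
  obtain ⟨⟨u, z⟩, huz⟩ := e
  simp only [mem_coe] at heS heS' huz
  obtain ⟨c, hc⟩ := ih (S.erase u) (erase_ssubset heS) (fun h => by
    have := mem_univ u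
    rw [← h] at this
    simp at this)
  have hsum : ∀ b, ((((S.erase u).filter (fun w => c w = b)).filter (fun w => G.Adj u w)).card +
      (((S.erase u).filter (fun w => c w = !b)).filter (fun w => G.Adj u w)).card) ≤
      q true + q false + 1 := by
    intro b
    rw [← card_union_of_disjoint]
    · have : G.degree u ≤ q true + q false + 2 := hdeg u
      rw [← G.card_neighborFinset_eq_degree] at this
      have hlt := card_lt_card (s := ((S.erase u).filter (fun w => c w = b)).filter
        (fun w => G.Adj u w) ∪ ((S.erase u).filter (fun w => c w = !b)).filter
        (fun w => G.Adj u w)) (t := G.neighborFinset u) (by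
          rw [Finset.ssubset_iff_of_subset]
          · refine ⟨z, by simpa using huz, ?_⟩
            simp [heS']
          · intro w hw
            simp only [mem_union, mem_filter] at hw
            rw [SimpleGraph.mem_neighborFinset]
            tauto)
      omega
    · rw [disjoint_left]
      intro w h1 h2
      simp only [mem_filter] at h1 h2
      have := h1.1.2.symm.trans h2.1.2
      simp at this
  obtain ⟨b, hb⟩ : ∃ b, (((S.erase u).filter (fun w => c w = b)).filter
      (fun w => G.Adj u w)).card ≤ q b := by
    have := hsum true
    by_contra! h
    have h1 := h true
    have h2 := h false
    simp only [Bool.not_true] at this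
    omega
  refine ⟨Function.update c u b, fun b' => ?_⟩
  by_cases hbb : b' = b
  · subst hbb
    refine ((hc b').insert hb).mono fun w hw => ?_
    simp only [mem_filter, mem_insert, mem_erase] at hw ⊢
    by_cases hwu : w = u
    · exact Or.inl hwu
    · rw [Function.update_of_ne hwu] at hw
      tauto
  · refine (hc b').mono fun w hw => ?_
    simp only [mem_filter, mem_erase] at hw ⊢
    by_cases hwu : w = u
    · subst hwu
      simp only [Function.update_self] at hw
      exact absurd hw.2.symm hbb
    · rw [Function.update_of_ne hwu] at hw
      tauto

theorem exists_isHoleColoring (hconn : G.Connected)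
    (hdeg : ∀ v, G.degree v ≤ q true + q false + 2) (h : V) : ∃ c, IsHoleColoring G q h c :=
  exists_coloring_of_ne_univ hconn hdeg (univ.erase h)
    (fun he => by
      have := mem_univ h
      rw [← he] at this
      simp at this)

/-- In a graph without a partition, the hole has exactly `q b + 1` neighbours of colour `b`. -/
theorem IsHoleColoring.card_neighbors (hno : NoPartition G q)
    (hdeg : ∀ v, G.degree v = q true + q false + 2) {h : V} {c : V → Bool}
    (hc : IsHoleColoring G q h c) (b : Bool) :
    ((G.neighborFinset h).filter (fun u => c u = b)).card = q b + 1 := by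
  have heq : ∀ b, ((univ.erase h).filter (fun u => c u = b)).filter (fun u => G.Adj h u) =
      (G.neighborFinset h).filter (fun u => c u = b) := by
    intro b
    ext u
    simp only [mem_filter, mem_erase, mem_univ, SimpleGraph.mem_neighborFinset]
    have : G.Adj h u → u ≠ h := fun h => h.ne'
    tauto
  have hlow : ∀ b, q b + 1 ≤ ((G.neighborFinset h).filter (fun u => c u = b)).card := by
    intro b
    by_contra! hlt
    rw [← heq b] at hlt
    refine hno (Function.update c h b) fun b' => ?_
    by_cases hbb : b' = b
    · subst hbb
      refine ((hc b').insert (Nat.lt_succ_iff.1 hlt)).mono fun w hw => ?_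
      simp only [mem_filter, mem_insert, mem_erase, mem_univ] at hw ⊢
      by_cases hwu : w = h
      · exact Or.inl hwu
      · rw [Function.update_of_ne hwu] at hw
        tauto
    · refine (hc b').mono fun w hw => ?_
      simp only [mem_filter, mem_erase, mem_univ] at hw ⊢
      by_cases hwu : w = h
      · subst hwu
        simp only [Function.update_self] at hw
        exact absurd hw.2.symm hbb
      · rw [Function.update_of_ne hwu] at hw
        tauto
  have hsum := card_filter_add_card_filter_not (s := G.neighborFinset h) (fun u => c u = true)
  simp only [Bool.not_eq_true] at hsum
  rw [G.card_neighborFinset_eq_degree, hdeg] at hsum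
  have h1 := hlow true
  have h2 := hlow false
  cases b <;> omega

/-- The hole can be moved to a neighbour `u`, whose colour is passed on to the old hole. -/
theorem IsHoleColoring.move (hno : NoPartition G q)
    (hdeg : ∀ v, G.degree v = q true + q false + 2) {h u : V} {c : V → Bool}
    (hc : IsHoleColoring G q h c) (hu : G.Adj h u) :
    IsHoleColoring G q u (Function.update c h (c u)) := by
  intro b
  by_cases hb : b = c u
  · have hcard := hc.card_neighbors hno hdeg b
    refine (((hc b).mono (erase_subset u _)).insert (v := h) ?_).mono fun w hw => ?_
    · have : ((((univ.erase h).filter (fun w => c w = b)).erase u).filter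
          (fun w => G.Adj h w)) ⊆ ((G.neighborFinset h).filter (fun w => c w = b)).erase u := by
        intro w hw
        simp only [mem_filter, mem_erase, mem_univ, SimpleGraph.mem_neighborFinset] at hw ⊢
        tauto
      refine (card_le_card this).trans ?_
      rw [card_erase_of_mem (by simp [hu, hb]), hcard]
      simp
    · simp only [mem_filter, mem_insert, mem_erase, mem_univ] at hw ⊢
      by_cases hwh : w = h
      · exact Or.inl hwh
      · rw [Function.update_of_ne hwh] at hw
        tauto
  · refine (hc b).mono fun w hw => ?_
    simp only [mem_filter, mem_erase, mem_univ] at hw ⊢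
    by_cases hwh : w = h
    · subst hwh
      simp only [Function.update_self] at hw
      exact absurd hw.2.symm hb
    · rw [Function.update_of_ne hwh] at hw
      tauto

/-- The vertices reachable from `x` by walks that avoid `S` after their first vertex. -/
def reachAvoiding (G : SimpleGraph V) (S : Set V) (x : V) : Set V :=
  {y | ReflTransGen (fun a b => G.Adj a b ∧ b ∉ S) x y}

/-- Moving the hole through vertices outside `S` does not change the colours on `S`. -/
theorem IsHoleColoring.move_avoiding (hno : NoPartition G q)
    (hdeg : ∀ v, G.degree v = q true + q false + 2) {S : Set V} {u y : V} {c : V → Bool}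
    (hc : IsHoleColoring G q u c) (hu : u ∉ S) (hy : y ∈ reachAvoiding G S u) :
    y ∉ S ∧ ∃ c', IsHoleColoring G q y c' ∧ ∀ z ∈ S, c' z = c z := by
  induction hy with
  | refl => exact ⟨hu, c, hc, fun _ _ => rfl⟩
  | tail _ hab ih =>
    obtain ⟨ha, c', hc', h⟩ := ih
    refine ⟨hab.2, _, hc'.move hno hdeg hab.1, fun z hz => ?_⟩
    rw [Function.update_of_ne (by rintro rfl; exact ha hz), h z hz]

theorem IsHoleColoring.move_along (hno : NoPartition G q)
    (hdeg : ∀ v, G.degree v = q true + q false + 2) (hp : IsEar G v m p) {j : ℕ} (hj : j ≤ m)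
    {c : V → Bool} (hc : IsHoleColoring G q (p j) c) :
    ∃ c', IsHoleColoring G q (p m) c' ∧ (∀ i, j ≤ i → i < m → c' (p i) = c (p (i + 1))) ∧
      ∀ z, (∀ i, j ≤ i → i ≤ m → z ≠ p i) → c' z = c z := by
  induction hj using Nat.decreasingInduction generalizing c with
  | self => exact ⟨c, hc, fun i h1 h2 => by omega, fun _ _ => rfl⟩
  | of_succ k hk ih =>
    obtain ⟨c', h1, h2, h3⟩ := ih (hc.move hno hdeg (hp.adj k hk))
    refine ⟨c', h1, fun i hki him => ?_, fun z hz => ?_⟩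
    · rcases hki.eq_or_lt with rfl | hlt
      · rw [h3 _ fun i hi him' e => ?_, Function.update_self]
        have := hp.inj _ _ him.le him' e
        omega
      · rw [h2 i hlt him, Function.update_of_ne]
        intro e
        have := hp.inj _ _ him hk.le e
        omega
    · rw [h3 z fun i hi him => hz i (by omega) him,
        Function.update_of_ne (hz k le_rfl hk.le)]

theorem IsHoleColoring.rotate (hno : NoPartition G q)
    (hdeg : ∀ v, G.degree v = q true + q false + 2) (hp : IsEar G v m p)
    {c : V → Bool} (hc : IsHoleColoring G q v c) :
    ∃ c', IsHoleColoring G q v c' ∧ (∀ i, i < m → c' (p i) = c (p (i + 1))) ∧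
      c' (p m) = c (p 0) ∧ ∀ z, z ≠ v → (∀ i, i ≤ m → z ≠ p i) → c' z = c z := by
  have h0 : G.Adj v (p 0) := (hp.adj_iff 0 (Nat.zero_le _)).2 (Or.inl rfl)
  have hm : G.Adj v (p m) := (hp.adj_iff m le_rfl).2 (Or.inr rfl)
  obtain ⟨c', h1, h2, h3⟩ := (hc.move hno hdeg h0).move_along hno hdeg hp (Nat.zero_le m)
  refine ⟨_, h1.move hno hdeg hm.symm, fun i hi => ?_, ?_, fun z hzv hz => ?_⟩
  · rw [Function.update_of_ne, h2 i (Nat.zero_le _) hi, Function.update_of_ne (hp.ne _ hi)]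
    intro e
    have := hp.inj _ _ hi.le le_rfl e
    omega
  · rw [Function.update_self, h3 v fun i _ hi => (hp.ne i hi).symm, Function.update_self]
  · rw [Function.update_of_ne (hz m le_rfl), h3 z fun i _ hi => hz i hi,
      Function.update_of_ne hzv]

theorem IsHoleColoring.ear_last_eq (hno : NoPartition G q)
    (hdeg : ∀ v, G.degree v = q true + q false + 2) (hp : IsEar G v m p)
    {c : V → Bool} (hc : IsHoleColoring G q v c) : c (p m) = c (p 1) := by
  obtain ⟨c', hc', h1, h2, h3⟩ := hc.rotate hno hdeg hp
  have hm2 := hp.two_le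
  have h0m : p 0 ≠ p m := fun e => by
    have := hp.inj _ _ (Nat.zero_le _) le_rfl e
    omega
  have hsub : ({p 0, p m} : Finset V) ⊆ G.neighborFinset v := by
    intro z hz
    rw [SimpleGraph.mem_neighborFinset]
    rcases mem_insert.1 hz with rfl | hz
    · exact (hp.adj_iff 0 (Nat.zero_le _)).2 (Or.inl rfl)
    · rw [mem_singleton.1 hz]
      exact (hp.adj_iff m le_rfl).2 (Or.inr rfl)
  have key : ∀ f : V → Bool, IsHoleColoring G q v f →
      (∑ u ∈ G.neighborFinset v \ {p 0, p m}, if f u = true then 1 else 0) +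
      ((if f (p 0) = true then 1 else 0) + if f (p m) = true then 1 else 0) = q true + 1 := by
    intro f hf
    rw [← hf.card_neighbors hno hdeg true, card_filter, ← sum_sdiff hsub, sum_pair h0m]
  have e1 := key c hc
  have e2 := key c' hc'
  rw [h1 0 (by omega), h2] at e2
  have e3 : (∑ u ∈ G.neighborFinset v \ {p 0, p m}, if c' u = true then 1 else 0) =
      ∑ u ∈ G.neighborFinset v \ {p 0, p m}, if c u = true then 1 else 0 := by
    refine sum_congr rfl fun u hu => ?_
    simp only [mem_sdiff, SimpleGraph.mem_neighborFinset, mem_insert, mem_singleton,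
      not_or] at hu
    rw [h3 u hu.1.ne' fun i hi e => ?_]
    subst e
    rcases (hp.adj_iff i hi).1 hu.1 with rfl | rfl
    · exact hu.2.1 rfl
    · exact hu.2.2 rfl
  rw [e3] at e2
  have hz : (0 + 1 : ℕ) = 1 := rfl
  rw [hz] at e2
  rcases hA : c (p m) <;> rcases hB : c (p 1) <;> simp only [hA, hB] at e1 e2 ⊢
  all_goals
    simp only [if_true, Bool.false_eq_true, if_false] at e1 e2
    omega

/-- If `G - v` is connected, the hole can leave the ear's cycle at `v` through `u`, come back at
some `p j` and return to `v`, which deletes the colour of `p j` and appends that of `u`. -/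
theorem exists_detour (hno : NoPartition G q)
    (hdeg : ∀ v, G.degree v = q true + q false + 2) (hp : IsEar G v m p) {u : V}
    (hvu : G.Adj v u) (hu : ∀ i, i ≤ m → u ≠ p i)
    (hconn : p 0 ∈ reachAvoiding G {v} u) :
    ∃ j ≤ m, ∀ c, IsHoleColoring G q v c → ∃ d, IsHoleColoring G q v d ∧ d (p m) = c u ∧
      (∀ i, i < j → i < m → d (p i) = c (p i)) ∧
      ∀ i, j ≤ i → i < m → d (p i) = c (p (i + 1)) := by
  set C : Set V := {z | z = v ∨ ∃ i ≤ m, z = p i} with hC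
  have huC : u ∉ C := by
    rintro (rfl | ⟨i, hi, e⟩)
    · exact G.irrefl hvu
    · exact hu i hi e
  obtain ⟨y, hy, j, hj, hyj⟩ : ∃ y ∈ reachAvoiding G C u, ∃ j ≤ m, G.Adj y (p j) := by
    by_contra! hcon
    have hall : ∀ z ∈ reachAvoiding G {v} u, z ∈ reachAvoiding G C u ∧ z ∉ C := by
      intro z hz
      induction hz with
      | refl => exact ⟨ReflTransGen.refl, huC⟩
      | @tail a b _ hab ih =>
        have hb : b ∉ C := by
          rintro (rfl | ⟨i, hi, rfl⟩)
          · exact hab.2 rfl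
          · exact hcon a ih.1 i hi hab.1
        exact ⟨ReflTransGen.tail ih.1 ⟨hab.1, hb⟩, hb⟩
    exact (hall _ hconn).2 (Or.inr ⟨0, Nat.zero_le _, rfl⟩)
  have hm : G.Adj v (p m) := (hp.adj_iff m le_rfl).2 (Or.inr rfl)
  refine ⟨j, hj, fun c hc => ?_⟩
  obtain ⟨hyC, c₂, hc₂, hcC⟩ := (hc.move hno hdeg hvu).move_avoiding hno hdeg huC hy
  obtain ⟨c₄, hc₄, h4, h4'⟩ := (hc₂.move hno hdeg hyj).move_along hno hdeg hp hj
  have hpC : ∀ i ≤ m, p i ∈ C := fun i hi => Or.inr ⟨i, hi, rfl⟩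
  have hne : ∀ z ∈ C, z ≠ y := fun z hz e => hyC (e ▸ hz)
  have h3 : ∀ i ≤ m, Function.update c₂ y (c₂ (p j)) (p i) = c (p i) := by
    intro i hi
    rw [Function.update_of_ne (hne _ (hpC i hi)), hcC _ (hpC i hi),
      Function.update_of_ne (hp.ne i hi)]
  have hpm : ∀ i, i < m → p i ≠ p m := fun i hi e => by
    have := hp.inj _ _ hi.le le_rfl e
    omega
  refine ⟨_, hc₄.move hno hdeg hm.symm, ?_, fun i hij him => ?_, fun i hij him => ?_⟩
  · rw [Function.update_self, h4' v fun i _ hi => (hp.ne i hi).symm,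
      Function.update_of_ne (hne v (Or.inl rfl)), hcC v (Or.inl rfl), Function.update_self]
  · rw [Function.update_of_ne (hpm i him), h4' _ fun k hk hkm e => ?_, h3 i him.le]
    have := hp.inj _ _ him.le hkm e
    omega
  · rw [Function.update_of_ne (hpm i him), h4 i hij him, h3 _ him]

theorem not_noPartition_of_isEar (hconn : G.Connected)
    (hdeg : ∀ v, G.degree v = q true + q false + 2) (hq : 1 ≤ q true + q false)
    (hp : IsEar G v m p)
    (hv : ∀ u, G.Adj v u → p 0 ∈ reachAvoiding G {v} u) : ¬ NoPartition G q := by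
  intro hno
  have hm2 := hp.two_le
  obtain ⟨c, hc⟩ := exists_isHoleColoring hconn (fun v => (hdeg v).le) v
  obtain ⟨c', hc', h1, h2, h3⟩ := hc.rotate hno hdeg hp
  have f0 := hc.ear_last_eq hno hdeg hp
  have f1 := hc'.ear_last_eq hno hdeg hp
  rw [h2, h1 1 (by omega)] at f1
  have hend : ∀ i ≤ m, G.Adj v (p i) → p i = p 0 ∨ p i = p m := by
    intro i hi h
    rcases (hp.adj_iff i hi).1 h with rfl | rfl
    · exact Or.inl rfl
    · exact Or.inr rfl
  by_cases hmono : c (p 0) = c (p 1)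
  · obtain ⟨u, hu⟩ : ((G.neighborFinset v).filter (fun u => c u = !c (p 0))).Nonempty := by
      rw [← card_pos, hc.card_neighbors hno hdeg]
      omega
    rw [mem_filter, SimpleGraph.mem_neighborFinset] at hu
    have huC : ∀ i, i ≤ m → u ≠ p i := by
      rintro i hi rfl
      rcases hend i hi hu.1 with e | e
      · have := hu.2
        rw [e] at this
        simp at this
      · have := hu.2
        rw [e, f0, hmono] at this
        simp at this
    obtain ⟨j, hj, hT⟩ := exists_detour hno hdeg hp hu.1 huC (hv u hu.1)
    obtain ⟨d, hd, e1, e2, e3⟩ := hT c hc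
    have f := hd.ear_last_eq hno hdeg hp
    have hu2 := hu.2
    rw [← e1, f] at hu2
    by_cases hj1 : 1 < j
    · rw [e2 1 hj1 (by omega), ← hmono] at hu2
      simp at hu2
    · rw [e3 1 (by omega) (by omega), ← f1] at hu2
      simp at hu2
  · have hm3 : 3 ≤ m := by
      by_contra h
      have : m = 2 := by omega
      subst this
      exact hmono (f1.trans f0)
    obtain ⟨c'', hc'', k1, k2, -⟩ := hc'.rotate hno hdeg hp
    have f2 := hc''.ear_last_eq hno hdeg hp
    rw [k2, k1 1 (by omega), h1 0 (by omega), h1 2 (by omega)] at f2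
    obtain ⟨u, hu, huC⟩ : ∃ u, G.Adj v u ∧ ∀ i, i ≤ m → u ≠ p i := by
      by_contra! hcon
      have hsub : G.neighborFinset v ⊆ {p 0, p m} := by
        intro u hu
        rw [SimpleGraph.mem_neighborFinset] at hu
        obtain ⟨i, hi, rfl⟩ := hcon u hu
        simpa using hend i hi hu
      have := (card_le_card hsub).trans card_le_two
      rw [G.card_neighborFinset_eq_degree, hdeg] at this
      omega
    obtain ⟨j, hj, hT⟩ := exists_detour hno hdeg hp hu huC (hv u hu)
    obtain ⟨d, hd, e1, e2, e3⟩ := hT c hc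
    obtain ⟨d', hd', e1', e2', e3'⟩ := hT c' hc'
    have f := hd.ear_last_eq hno hdeg hp
    have f' := hd'.ear_last_eq hno hdeg hp
    rw [e1] at f
    rw [e1', h3 u hu.ne' huC] at f'
    by_cases hj1 : 1 < j
    · rw [e2 1 hj1 (by omega)] at f
      rw [e2' 1 hj1 (by omega), h1 1 (by omega)] at f'
      exact hmono (f1.trans (f'.symm.trans f))
    · rw [e3 1 (by omega) (by omega)] at f
      rw [e3' 1 (by omega) (by omega), h1 2 (by omega)] at f'
      exact hmono (f1.trans (f.symm.trans (f'.trans f2.symm)))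

/-- A connected regular graph with two distinct non-adjacent vertices contains an ear at a vertex
that is not a cut vertex. -/
theorem exists_isEar_of_not_adj (hconn : G.Connected) {Δ : ℕ} (hdeg : ∀ v, G.degree v = Δ)
    {x y : V} (hxy : x ≠ y) (hnadj : ¬ G.Adj x y) :
    ∃ v m p, IsEar G v m p ∧ ∀ u, G.Adj v u → p 0 ∈ reachAvoiding G {v} u := by
  classical
  let N : V → Set V := fun v => {z | z = v ∨ G.Adj v z}
  let far : V → Set V := fun v => reachAvoiding G (N v) x
  obtain ⟨v, hvx, hmax⟩ := Set.exists_max_image {v | x ∉ N v} (fun v => (far v).ncard)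
    (Set.toFinite _) ⟨y, by rintro (h | h); exacts [hxy h, hnadj h.symm]⟩
  have hxW : x ∈ far v := ReflTransGen.refl
  have hWN : ∀ w ∈ far v, w ∉ N v := by
    intro w hw
    cases hw with
    | refl => exact hvx
    | tail _ h => exact h.2
  have hclosed : ∀ w ∈ far v, ∀ z, G.Adj w z → z ∉ far v → G.Adj v z := by
    intro w hw z hwz hz
    by_contra hvz
    refine hz (ReflTransGen.tail hw ⟨hwz, ?_⟩)
    rintro (rfl | h)
    · exact hWN w hw (Or.inr hwz.symm)
    · exact hvz h
  have hdom : ∀ w ∈ far v, ∀ s, G.Adj w s → s ∉ far v → ∀ y,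
      ∃ z, (z ∈ far v ∨ z = s) ∧ (z = y ∨ G.Adj y z) := by
    intro w hw s hws hs y
    by_contra! hcon
    have hsub : insert s (far v) ⊆ far y := by
      have hW : far v ⊆ far y := by
        intro z hz
        induction hz with
        | refl => exact ReflTransGen.refl
        | tail h hab ih =>
          refine ReflTransGen.tail ih ⟨hab.1, ?_⟩
          rintro (e | e)
          · exact (hcon _ (Or.inl (ReflTransGen.tail h hab))).1 e
          · exact (hcon _ (Or.inl (ReflTransGen.tail h hab))).2 e
      refine Set.insert_subset (ReflTransGen.tail (hW hw) ⟨hws, ?_⟩) hW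
      rintro (e | e)
      · exact (hcon _ (Or.inr rfl)).1 e
      · exact (hcon _ (Or.inr rfl)).2 e
    have hlt := Set.ncard_le_ncard hsub (Set.toFinite _)
    rw [Set.ncard_insert_of_notMem hs (Set.toFinite _)] at hlt
    have := hmax y (by
      rintro (e | e)
      · exact (hcon _ (Or.inl hxW)).1 e
      · exact (hcon _ (Or.inl hxW)).2 e)
    omega
  have hvW : v ∉ far v := fun h => hWN v h (Or.inl rfl)
  obtain ⟨a, ha, s, hsW, has⟩ : ∃ a ∈ far v, ∃ s, s ∉ far v ∧ G.Adj a s := by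
    obtain ⟨w⟩ := hconn.preconnected x v
    obtain ⟨e, -, h1, h2⟩ := w.exists_boundary_dart (far v) hxW hvW
    exact ⟨e.fst, h1, e.snd, h2, e.adj⟩
  have hvs := hclosed a ha s has hsW
  obtain ⟨b, hb, t, htW, hbt, hst⟩ : ∃ b ∈ far v, ∃ t, t ∉ far v ∧ G.Adj b t ∧ s ≠ t := by
    by_contra! hcon
    let Z : Finset V := univ.filter fun z => z ∉ far v ∧ z ≠ s
    have hvZ : v ∈ Z := by simp [Z, hvW, hvs.ne]
    have hsZ : ∀ z ∈ Z, G.Adj s z := by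
      intro z hz
      simp only [Z, mem_filter, mem_univ, true_and] at hz
      obtain ⟨w, hw | rfl, rfl | h⟩ := hdom a ha s has hsW z
      · exact absurd hw hz.1
      · exact absurd (hcon w hw z hz.1 h.symm) hz.2.symm
      · exact absurd rfl hz.2
      · exact h.symm
    have haZ : a ∉ Z := by simp [Z, ha]
    have hle : (insert a Z).card ≤ (G.neighborFinset s).card := by
      refine card_le_card fun z hz => ?_
      rw [SimpleGraph.mem_neighborFinset]
      rcases mem_insert.1 hz with rfl | hz
      · exact has.symm
      · exact hsZ z hz
    have hle' : (G.neighborFinset v).card ≤ (insert s (Z.erase v)).card := by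
      refine card_le_card fun z hz => ?_
      rw [SimpleGraph.mem_neighborFinset] at hz
      simp only [mem_insert, mem_erase, Z, mem_filter, mem_univ, true_and]
      by_cases hzs : z = s
      · exact Or.inl hzs
      · exact Or.inr ⟨hz.ne', fun h => hWN z h (Or.inr hz), hzs⟩
    rw [card_insert_of_notMem haZ, G.card_neighborFinset_eq_degree, hdeg] at hle
    have := card_insert_le s (Z.erase v)
    rw [card_erase_of_mem hvZ] at this
    have hpos := card_pos.2 ⟨v, hvZ⟩
    rw [G.card_neighborFinset_eq_degree, hdeg] at hle'
    omega
  have hvt := hclosed b hb t hbt htW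
  have hWself : ∀ w ∈ far v, ReflTransGen (fun a b => G.Adj a b ∧ a ∈ far v ∧ b ∈ far v) x w := by
    intro w hw
    induction hw with
    | refl => exact ReflTransGen.refl
    | tail h hab ih => exact ReflTransGen.tail ih ⟨hab.1, h, ReflTransGen.tail h hab⟩
  obtain ⟨m, p, hp⟩ := exists_isEar (G := G) (v := v)
    (fun w hw => ⟨fun e => hWN w hw (Or.inl e), fun e => hWN w hw (Or.inr e)⟩)
    hWself hvs hvt hst ha hb has.symm hbt.symm
  refine ⟨v, m, p, hp, ?_⟩
  have hfar : far v ⊆ reachAvoiding G {v} x := by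
    intro w hw
    exact ReflTransGen.mono (fun c d (h : G.Adj c d ∧ d ∉ N v) =>
      (⟨h.1, fun e => h.2 (Or.inl e)⟩ : G.Adj c d ∧ d ∉ ({v} : Set V))) _ _ hw
  have hcut : ∀ y, y ≠ v → y ∈ reachAvoiding G {v} x := by
    intro y hy
    obtain ⟨z, hz, hyz⟩ := hdom a ha s has hsW y
    have hzr : z ∈ reachAvoiding G {v} x := by
      rcases hz with hz | rfl
      · exact hfar hz
      · exact ReflTransGen.tail (hfar ha) ⟨has, hvs.ne'⟩
    rcases hyz with rfl | h
    · exact hzr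
    · exact ReflTransGen.tail hzr ⟨h.symm, hy⟩
  have hxv : x ≠ v := fun e => hvx (Or.inl e)
  have hsymm : ∀ y ∈ reachAvoiding G {v} x, y ≠ v ∧ x ∈ reachAvoiding G {v} y := by
    intro y hy
    induction hy with
    | refl => exact ⟨hxv, ReflTransGen.refl⟩
    | tail _ h ih => exact ⟨h.2, ReflTransGen.head ⟨h.1.symm, ih.1⟩ ih.2⟩
  intro u hu
  exact (hsymm u (hcut u hu.ne')).2.trans (hcut _ (hp.ne 0 (Nat.zero_le _)))

theorem nonempty_iso_top_of_forall_adj {Δ : ℕ} (hdeg : ∀ v, G.degree v = Δ) {x : V}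
    (hall : ∀ x y, x ≠ y → G.Adj x y) :
    Nonempty (G ≃g (⊤ : SimpleGraph (Fin (Δ + 1)))) := by
  have hN : G.neighborFinset x = univ.erase x := by
    ext y
    simp only [SimpleGraph.mem_neighborFinset, mem_erase, mem_univ, and_true]
    exact ⟨fun h => h.ne', fun h => hall x y h.symm⟩
  have hcard : Fintype.card V = Δ + 1 := by
    have h := G.card_neighborFinset_eq_degree x
    rw [hN, hdeg, card_erase_of_mem (mem_univ x), card_univ] at h
    have : 0 < Fintype.card V := Fintype.card_pos_iff.2 ⟨x⟩
    omega
  refine ⟨⟨Fintype.equivFinOfCardEq hcard, fun {a b} => ?_⟩⟩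
  simp only [SimpleGraph.top_adj, ne_eq, EmbeddingLike.apply_eq_iff_eq]
  exact ⟨hall a b, fun h => h.ne⟩

end Bipartitioning

/-- Let `Δ ≥ 3` and let `G` be a finite connected `Δ`-regular graph not isomorphic
to `K_{Δ+1}`.  For all non-negative integers `pA, pB` with `pA + pB = Δ - 2`, the
vertex set of `G` can be partitioned into sets `A` and `B` with `G[A]`
`pA`-degenerate and `G[B]` `pB`-degenerate. -/
theorem regular_bipartitioning {V : Type*} [Fintype V] [DecidableEq V]
    (G : SimpleGraph V) [DecidableRel G.Adj] (Δ : ℕ) (hΔ : 3 ≤ Δ)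
    (hconn : G.Connected) (hreg : G.IsRegularOfDegree Δ)
    (hK : ¬ Nonempty (G ≃g (⊤ : SimpleGraph (Fin (Δ + 1)))))
    (pA pB : ℕ) (hsum : pA + pB = Δ - 2) :
    ∃ A B : Finset V,
      Disjoint A B ∧ A ∪ B = Finset.univ ∧
      DegenerateOn G A pA ∧ DegenerateOn G B pB := by
  classical
  obtain ⟨x⟩ := hconn.nonempty
  obtain ⟨y, z, hyz, hnadj⟩ : ∃ y z, y ≠ z ∧ ¬ G.Adj y z := by
    by_contra! h
    exact hK (nonempty_iso_top_of_forall_adj hreg (x := x) h)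
  obtain ⟨v, m, p, hp, hv⟩ := exists_isEar_of_not_adj hconn hreg hyz hnadj
  let q : Bool → ℕ := fun b => cond b pA pB
  have hnot : ¬ NoPartition G q := by
    refine not_noPartition_of_isEar hconn (fun v => ?_) ?_ hp hv
    · rw [hreg v]
      simp only [q, cond_true, cond_false]
      omega
    · simp only [q, cond_true, cond_false]
      omega
  obtain ⟨c, hc⟩ : ∃ c : V → Bool,
      ∀ b, DegenerateOn G (Finset.univ.filter (fun u => c u = b)) (q b) := by
    by_contra! h
    exact hnot fun c hc => (h c).elim fun b hb => hb (hc b)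
  refine ⟨_, _, ?_, ?_, hc true, hc false⟩
  · rw [Finset.disjoint_left]
    intro u h1 h2
    simp_all
  · ext u
    simp
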